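/- Under the flotation setup with det(γ'(s), γ''(s)) > 0 for all s, suppose (i) there exist z ∈ ℝ² and λ > 0 such that r₂(s) = z + λ·(r₁(s) − z) for all s (the flotation curve Π_δ(K) is homothetic to the buoyancy curve Γ_δ(K)), and (ii) every chord of flotation cuts off from the boundary exactly one third of its total affine arc length: ∫_s^{t(s)} det(γ'(u), γ''(u))^{1/3} du = (1/3)·∫₀^L det(γ'(u), γ''(u))^{1/3} du for all s. Then the image of γ is an ellipse. -/

import Mathlib

open Real MeasureTheory intervalIntegral

noncomputable section

/-- The Euclidean plane. -/
abbrev R2 := EuclideanSpace ℝ (Fin 2)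

/-- The planar determinant `det(u,v) = u₁v₂ − u₂v₁`. -/
def det2 (u v : R2) : ℝ := u 0 * v 1 - u 1 * v 0

/-- The flotation curve `r₁(s) = (γ(s) + γ(t(s)))/2`. -/
def flotCurve (γ : ℝ → R2) (t : ℝ → ℝ) (s : ℝ) : R2 := ((1:ℝ)/2) • (γ s + γ (t s))

/-- The buoyancy (centroid) curve
`r₂(s) = γ(s) + (1/(3δ))·∫_s^{t(s)} det(γ(u) − γ(s), γ'(u))·(γ(u) − γ(s)) du`. -/
def buoyCurve (γ : ℝ → R2) (t : ℝ → ℝ) (δ : ℝ) (s : ℝ) : R2 :=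
  γ s + (1/(3*δ)) • ∫ u in s..t s, det2 (γ u - γ s) (deriv γ u) • (γ u - γ s)

/-- A compact set with nonempty interior whose frontier lies on the unit sphere has the whole
sphere as its frontier. -/
theorem frontier_eq_sphere_of_subset {E : Type*} [NormedAddCommGroup E] [NormedSpace ℝ E]
    {K : Set E} (hK : IsCompact K) (hint : (interior K).Nonempty)
    (hfr : frontier K ⊆ Metric.sphere 0 1) : frontier K = Metric.sphere 0 1 := by
  have hsub : K ⊆ Metric.closedBall 0 1 := by
    obtain ⟨x, hxK, hx⟩ := hK.exists_isMaxOn (hint.mono interior_subset)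
      (f := fun x => ‖x‖) continuous_norm.continuousOn
    have hx1 : ‖x‖ ≤ 1 := by
      by_contra! h
      have hKx : K ⊆ Metric.closedBall 0 ‖x‖ := fun y hy => by
        simpa using hx hy
      have hxi : x ∈ interior K := by
        by_contra hn
        have h1 : x ∈ frontier K := ⟨subset_closure hxK, hn⟩
        have h2 := hfr h1
        rw [mem_sphere_zero_iff_norm] at h2
        linarith
      have h3 := interior_mono hKx hxi
      rw [interior_closedBall _ (by positivity)] at h3
      simp at h3
    intro y hy
    have : ‖y‖ ≤ ‖x‖ := hx hy
    simpa using this.trans hx1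
  have hintsub : interior K ⊆ Metric.ball 0 1 := by
    have := interior_mono hsub
    rwa [interior_closedBall _ one_ne_zero] at this
  have hball : Metric.ball 0 1 ⊆ K := by
    obtain ⟨x, hx⟩ := hint
    refine ((convex_ball (0 : E) 1).isPreconnected.subset_left_of_subset_union isOpen_interior
      hK.isClosed.isOpen_compl (disjoint_compl_right.mono_left interior_subset) (fun y hy => ?_)
      ⟨x, hintsub hx, hx⟩).trans interior_subset
    by_contra hn
    rw [Set.mem_union, not_or, Set.mem_compl_iff, not_not] at hn
    have h1 := hfr ⟨subset_closure hn.2, hn.1⟩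
    rw [mem_sphere_zero_iff_norm] at h1
    rw [mem_ball_zero_iff] at hy
    linarith
  refine hfr.antisymm fun x hx => ?_
  have hxK : x ∈ closure K := by
    refine closure_mono hball ?_
    rw [closure_ball _ one_ne_zero]
    exact Metric.sphere_subset_closedBall hx
  refine ⟨hxK, fun hxi => ?_⟩
  have h1 := hintsub hxi
  rw [mem_sphere_zero_iff_norm] at hx
  rw [mem_ball_zero_iff] at h1
  linarith

/-- The linear automorphism of the plane with prescribed independent columns. -/
theorem exists_linearEquiv_of_det2_ne_zero (u w : R2) (h : det2 u w ≠ 0) :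
    ∃ T : R2 ≃ₗ[ℝ] R2, ∀ y : R2, T y = y 0 • u + y 1 • w := by
  let f : R2 →ₗ[ℝ] R2 :=
    { toFun := fun y => y 0 • u + y 1 • w
      map_add' := fun a b => by ext i; simp; ring
      map_smul' := fun a b => by ext i; simp; ring }
  have hf : Function.Injective f := by
    rw [injective_iff_map_eq_zero]
    intro y hy
    have h0 : y 0 * u 0 + y 1 * w 0 = 0 := by simpa [f] using congrArg (fun v : R2 => v 0) hy
    have h1 : y 0 * u 1 + y 1 * w 1 = 0 := by simpa [f] using congrArg (fun v : R2 => v 1) hy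
    have e0 : y 0 * det2 u w = 0 := by
      unfold det2; linear_combination w 1 * h0 - w 0 * h1
    have e1 : y 1 * det2 u w = 0 := by
      unfold det2; linear_combination u 0 * h1 - u 1 * h0
    ext i
    fin_cases i
    · simpa [h] using e0
    · simpa [h] using e1
  exact ⟨LinearEquiv.ofInjectiveEndo f hf, fun y => rfl⟩

/-- If the frontier of a compact set with nonempty interior satisfies the equation of an
ellipse with conjugate half-axes `u`, `w` centred at `g`, then the frontier is that ellipse. -/
theorem exists_frontier_eq_ellipse {K : Set R2} (hK : IsCompact K) (hint : (interior K).Nonempty)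
    (u w g : R2) (h : det2 u w ≠ 0)
    (hfr : ∀ x ∈ frontier K, det2 (x - g) w ^ 2 + det2 u (x - g) ^ 2 = det2 u w ^ 2) :
    ∃ (T : R2 ≃ₗ[ℝ] R2) (b : R2),
      frontier K = (fun x => T x + b) '' Metric.sphere (0:R2) 1 := by
  obtain ⟨T, hT⟩ := exists_linearEquiv_of_det2_ne_zero u w h
  refine ⟨T, g, ?_⟩
  let φ : R2 ≃ₜ R2 := T.toContinuousLinearEquiv.toHomeomorph.trans (Homeomorph.addRight g)
  have hφ : ∀ x, φ x = T x + g := fun x => rfl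
  have key : frontier (φ ⁻¹' K) = Metric.sphere 0 1 := by
    refine frontier_eq_sphere_of_subset ?_ ?_ ?_
    · exact φ.isCompact_preimage.2 hK
    · rw [← φ.preimage_interior]
      exact hint.preimage φ.surjective
    · rw [← φ.preimage_frontier]
      intro y hy
      have h1 := hfr _ hy
      rw [hφ, add_sub_cancel_right, hT] at h1
      rw [mem_sphere_zero_iff_norm, EuclideanSpace.norm_eq, Real.sqrt_eq_one, Fin.sum_univ_two]
      simp only [Real.norm_eq_abs, sq_abs]
      have h2 : det2 u w ^ 2 ≠ 0 := pow_ne_zero _ h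
      apply mul_right_cancel₀ h2
      simp only [det2, PiLp.add_apply, PiLp.smul_apply, smul_eq_mul] at h1 ⊢
      linear_combination h1
  rw [← φ.preimage_frontier] at key
  rw [← key]
  exact (Set.image_preimage_eq _ φ.surjective).symm

/-- A component of the derivative of the homothety relation between the flotation and the
buoyancy curve, in coordinates. -/
theorem flotation_velocity_coord {x y x' y' t t' : ℝ → ℝ} {δ lam z : ℝ} (hδ : δ ≠ 0)
    (hx : ∀ s, HasDerivAt x (x' s) s) (hy : ∀ s, HasDerivAt y (y' s) s)
    (hx' : Continuous x') (hy' : Continuous y') (ht : ∀ s, HasDerivAt t (t' s) s)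
    (hA : ∀ s, ∫ u in s..t s, ((x u - x s) * y' u - (y u - y s) * x' u) = 2 * δ)
    (hB : ∀ s, x s + 1 / (3 * δ) *
      (∫ u in s..t s, ((x u - x s) * y' u - (y u - y s) * x' u) * (x u - x s)) =
      z + lam * (1 / 2 * (x s + x (t s)) - z)) (s : ℝ) :
    3 * δ * lam * (x' s + t' s * x' (t s)) =
      (x' s * (y (t s) - y s) - y' s * (x (t s) - x s)) * (x (t s) - x s) := by
  have cx : Continuous x := continuous_iff_continuousAt.2 fun s => (hx s).continuousAt
  have cy : Continuous y := continuous_iff_continuousAt.2 fun s => (hy s).continuousAt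
  let G : ℝ → ℝ := fun v => ∫ u in (0:ℝ)..v, (x u * y' u - y u * x' u)
  let H : ℝ → ℝ := fun v => ∫ u in (0:ℝ)..v, (x u * y' u - y u * x' u) * x u
  have hG : ∀ v, HasDerivAt G (x v * y' v - y v * x' v) v := fun v =>
      (integral_hasDerivAt_right (Continuous.intervalIntegrable (by fun_prop) _ _)
        (Continuous.stronglyMeasurableAtFilter (by fun_prop) _ _)
        (Continuous.continuousAt (by fun_prop)))
  have hH : ∀ v, HasDerivAt H ((x v * y' v - y v * x' v) * x v) v := fun v =>
      (integral_hasDerivAt_right (Continuous.intervalIntegrable (by fun_prop) _ _)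
        (Continuous.stronglyMeasurableAtFilter (by fun_prop) _ _)
        (Continuous.continuousAt (by fun_prop)))
  have eG : ∀ s, G (t s) - G s - (x s * y (t s) - y s * x (t s)) = 2 * δ := by
    intro s
    rw [← hA s, integral_eq_sub_of_hasDerivAt (f := fun v => G v - (x s * y v - y s * x v))
      (fun v _ => (((hG v).sub (((hy v).const_mul (x s)).sub
        ((hx v).const_mul (y s)))).congr_deriv (by ring)))
      (Continuous.intervalIntegrable (by fun_prop) _ _)]
    ring
  have eH : ∀ s, H (t s) - H s - 1 / 2 * ((x s * y (t s) - y s * x (t s)) * (x s + x (t s))) =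
      3 * δ * (z + lam * (1 / 2 * (x s + x (t s)) - z)) := by
    intro s
    rw [← hB s, integral_eq_sub_of_hasDerivAt (f := fun v => H v -
        1 / 2 * ((x s * y v - y s * x v) * x v + G v * x s) - G v * x s
        + (x s * y v - y s * x v) * x s)
      (fun v _ => ((((hH v).sub ((((((hy v).const_mul (x s)).sub
        ((hx v).const_mul (y s))).mul (hx v)).add ((hG v).mul_const (x s))).const_mul (1/2))).sub
        ((hG v).mul_const (x s))).add ((((hy v).const_mul (x s)).sub
        ((hx v).const_mul (y s))).mul_const (x s))).congr_deriv (by simp only [Pi.sub_apply]; ring))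
      (Continuous.intervalIntegrable (by fun_prop) _ _)]
    field_simp
    linear_combination 3 * x s * eG s
  have hxt : HasDerivAt (fun s => x (t s)) (x' (t s) * t' s) s := (hx (t s)).comp s (ht s)
  have hyt : HasDerivAt (fun s => y (t s)) (y' (t s) * t' s) s := (hy (t s)).comp s (ht s)
  have hGt := (hG (t s)).comp s (ht s)
  have hHt := (hH (t s)).comp s (ht s)
  have dD := ((hx s).mul hyt).sub ((hy s).mul hxt)
  have d1 := ((hGt.sub (hG s)).sub dD).unique
    ((hasDerivAt_const s (2 * δ)).congr_of_eventuallyEq (.of_forall eG))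
  have d2 := ((hHt.sub (hH s)).sub ((dD.mul ((hx s).add hxt)).const_mul (1 / 2))).unique
    (((((((hx s).add hxt).const_mul (1 / 2)).sub_const z).const_mul lam).const_add z
      |>.const_mul (3 * δ)).congr_of_eventuallyEq (.of_forall eH))
  simp only [Pi.add_apply, Pi.mul_apply, Pi.sub_apply] at d1 d2
  linear_combination (-2) * d2 + (2 * x (t s) + x s) * d1

/-- Three points moving along closed flotation chords: if `m (vᵢ + vᵢ₊₁) = det(vᵢ, cᵢ) cᵢ` with
the `det(vᵢ, cᵢ)` not summing to zero, each point moves parallel to the opposite side. -/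
theorem triangle_velocity {m a0 a1 b0 b1 c0 c1 u0 u1 v0 v1 w0 w1 : ℝ} (hm : m ≠ 0)
    (e10 : m * (u0 + v0) = (u0 * (b1 - a1) - u1 * (b0 - a0)) * (b0 - a0))
    (e11 : m * (u1 + v1) = (u0 * (b1 - a1) - u1 * (b0 - a0)) * (b1 - a1))
    (e20 : m * (v0 + w0) = (v0 * (c1 - b1) - v1 * (c0 - b0)) * (c0 - b0))
    (e21 : m * (v1 + w1) = (v0 * (c1 - b1) - v1 * (c0 - b0)) * (c1 - b1))
    (e30 : m * (w0 + u0) = (w0 * (a1 - c1) - w1 * (a0 - c0)) * (a0 - c0))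
    (e31 : m * (w1 + u1) = (w0 * (a1 - c1) - w1 * (a0 - c0)) * (a1 - c1))
    (hne : (u0 * (b1 - a1) - u1 * (b0 - a0)) + (v0 * (c1 - b1) - v1 * (c0 - b0)) +
      (w0 * (a1 - c1) - w1 * (a0 - c0)) ≠ 0) :
    (b0 - a0) * (c1 - b1) - (b1 - a1) * (c0 - b0) = m ∧
    ∃ d, (u0 = d * (b0 - c0) ∧ u1 = d * (b1 - c1)) ∧ (v0 = d * (c0 - a0) ∧ v1 = d * (c1 - a1)) ∧
      (w0 = d * (a0 - b0) ∧ w1 = d * (a1 - b1)) := by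
  set d1 := u0 * (b1 - a1) - u1 * (b0 - a0) with h1
  set d2 := v0 * (c1 - b1) - v1 * (c0 - b0) with h2
  set d3 := w0 * (a1 - c1) - w1 * (a0 - c0) with h3
  set D := (b0 - a0) * (c1 - b1) - (b1 - a1) * (c0 - b0) with hD
  have k1 : v0 * (b1 - a1) - v1 * (b0 - a0) = -d1 := by
    apply mul_left_cancel₀ hm
    linear_combination (b1 - a1) * e10 - (b0 - a0) * e11 - m * h1
  have k2 : w0 * (c1 - b1) - w1 * (c0 - b0) = -d2 := by
    apply mul_left_cancel₀ hm
    linear_combination (c1 - b1) * e20 - (c0 - b0) * e21 - m * h2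
  have k3 : u0 * (a1 - c1) - u1 * (a0 - c0) = -d3 := by
    apply mul_left_cancel₀ hm
    linear_combination (a1 - c1) * e30 - (a0 - c0) * e31 - m * h3
  have f1 : m * (d3 - d1 + d2) = d1 * D := by
    linear_combination (c1 - b1) * e10 - (c0 - b0) * e11 + m * h2 + m * h1 + m * k3 + d1 * hD
  have f2 : m * (d1 - d2 + d3) = d2 * D := by
    linear_combination (a1 - c1) * e20 - (a0 - c0) * e21 + m * h3 + m * h2 + m * k1 + d2 * hD
  have f3 : m * (d2 - d3 + d1) = d3 * D := by
    linear_combination (b1 - a1) * e30 - (b0 - a0) * e31 + m * h1 + m * h3 + m * k2 + d3 * hD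
  have hDm : D = m := by
    apply mul_left_cancel₀ hne
    linear_combination -f1 - f2 - f3
  rw [hDm] at f1 f2 f3
  have g2 : d2 = d1 := by
    apply mul_left_cancel₀ hm
    linear_combination (f1 - f2) / 3
  have g3 : d3 = d1 := by
    apply mul_left_cancel₀ hm
    linear_combination (f1 - f3) / 3
  have hD2 : m = (b0 - a0) * (c1 - b1) - (b1 - a1) * (c0 - b0) := by rw [← hDm]
  refine ⟨hDm, d1 / m, ?_⟩
  rw [g2] at h2 k2
  rw [g3] at h3 k3
  clear_value d1 d2 d3 D
  refine ⟨⟨?_, ?_⟩, ⟨?_, ?_⟩, ?_, ?_⟩ <;> rw [div_mul_eq_mul_div, eq_div_iff hm]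
  · linear_combination u0 * hD2 - (b0 - a0) * k3 - (a0 - c0) * h1
  · linear_combination u1 * hD2 - (b1 - a1) * k3 - (a1 - c1) * h1
  · linear_combination v0 * hD2 - (c0 - b0) * k1 - (b0 - a0) * h2
  · linear_combination v1 * hD2 - (c1 - b1) * k1 - (b1 - a1) * h2
  · linear_combination w0 * hD2 - (a0 - c0) * k2 - (c0 - b0) * h3
  · linear_combination w1 * hD2 - (a1 - c1) * k2 - (c1 - b1) * h3

/-- Three points each moving with velocity `φ` times the opposite side of their triangle stay on
the Steiner ellipse of the initial triangle. -/
theorem steiner_ellipse_invariant {p0 p1 q0 q1 r0 r1 φ : ℝ → ℝ} {m k : ℝ} (hk : k ^ 2 = 1 / 3)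
    (hp0 : ∀ s, HasDerivAt p0 (φ s * (q0 s - r0 s)) s)
    (hp1 : ∀ s, HasDerivAt p1 (φ s * (q1 s - r1 s)) s)
    (hq0 : ∀ s, HasDerivAt q0 (φ s * (r0 s - p0 s)) s)
    (hq1 : ∀ s, HasDerivAt q1 (φ s * (r1 s - p1 s)) s)
    (hr0 : ∀ s, HasDerivAt r0 (φ s * (p0 s - q0 s)) s)
    (hr1 : ∀ s, HasDerivAt r1 (φ s * (p1 s - q1 s)) s)
    (hm : ∀ s, (q0 s - p0 s) * (r1 s - q1 s) - (q1 s - p1 s) * (r0 s - q0 s) = m)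
    {g0 g1 : ℝ} (hg0 : 3 * g0 = p0 0 + q0 0 + r0 0) (hg1 : 3 * g1 = p1 0 + q1 0 + r1 0) (s : ℝ) :
    ((p0 s - g0) * (k * (q1 0 - r1 0)) - (p1 s - g1) * (k * (q0 0 - r0 0))) ^ 2 +
      ((p0 0 - g0) * (p1 s - g1) - (p1 0 - g1) * (p0 s - g0)) ^ 2 =
    ((p0 0 - g0) * (k * (q1 0 - r1 0)) - (p1 0 - g1) * (k * (q0 0 - r0 0))) ^ 2 := by
  have c0 : r0 s = 3 * g0 - p0 s - q0 s := by
    have h : ∀ v, HasDerivAt (fun v => p0 v + q0 v + r0 v) 0 v := fun v =>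
      (((hp0 v).add (hq0 v)).add (hr0 v)).congr_deriv (by ring)
    have := is_const_of_deriv_eq_zero (fun v => (h v).differentiableAt) (fun v => (h v).deriv) s 0
    linarith
  have c1 : r1 s = 3 * g1 - p1 s - q1 s := by
    have h : ∀ v, HasDerivAt (fun v => p1 v + q1 v + r1 v) 0 v := fun v =>
      (((hp1 v).add (hq1 v)).add (hr1 v)).congr_deriv (by ring)
    have := is_const_of_deriv_eq_zero (fun v => (h v).differentiableAt) (fun v => (h v).deriv) s 0
    linarith
  have i0 : r0 0 = 3 * g0 - p0 0 - q0 0 := by linarith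
  have i1 : r1 0 = 3 * g1 - p1 0 - q1 0 := by linarith
  have hF : ∀ X0 X1 : ℝ,
      ((p0 s - g0) * X1 - (p1 s - g1) * X0) ^ 2 + ((q0 s - g0) * X1 - (q1 s - g1) * X0) ^ 2 +
        ((r0 s - g0) * X1 - (r1 s - g1) * X0) ^ 2 =
      ((p0 0 - g0) * X1 - (p1 0 - g1) * X0) ^ 2 + ((q0 0 - g0) * X1 - (q1 0 - g1) * X0) ^ 2 +
        ((r0 0 - g0) * X1 - (r1 0 - g1) * X0) ^ 2 := by
    intro X0 X1
    have hdet : ∀ {f0 f1 : ℝ → ℝ} {d0 d1 v : ℝ}, HasDerivAt f0 d0 v → HasDerivAt f1 d1 v →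
        HasDerivAt (fun v => ((f0 v - g0) * X1 - (f1 v - g1) * X0) ^ 2)
          (2 * ((f0 v - g0) * X1 - (f1 v - g1) * X0) * (d0 * X1 - d1 * X0)) v := by
      intro f0 f1 d0 d1 v h0 h1
      exact ((((h0.sub_const g0).mul_const X1).sub
        ((h1.sub_const g1).mul_const X0)).pow 2).congr_deriv (by simp)
    have h := fun v => (((hdet (hp0 v) (hp1 v)).add (hdet (hq0 v) (hq1 v))).add
      (hdet (hr0 v) (hr1 v))).congr_deriv (g' := 0) (by ring)
    exact is_const_of_deriv_eq_zero (fun v => (h v).differentiableAt) (fun v => (h v).deriv) s 0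
  have hFs := hF (p0 s - g0) (p1 s - g1)
  have hms := hm s
  have hm0 := hm 0
  rw [c0, c1] at hFs hms
  rw [i0, i1] at hFs hm0
  have es : (p0 s - g0) * (q1 s - g1) - (p1 s - g1) * (q0 s - g0) = m / 3 := by
    linear_combination hms / 3
  have e0 : (p0 0 - g0) * (q1 0 - g1) - (p1 0 - g1) * (q0 0 - g0) = m / 3 := by
    linear_combination hm0 / 3
  have hs2 := congrArg (fun v => v ^ 2) es
  have h02 := congrArg (fun v => v ^ 2) e0
  have lhs : ((p0 s - g0) * (k * (q1 0 - r1 0)) - (p1 s - g1) * (k * (q0 0 - r0 0))) ^ 2 =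
      1 / 3 * ((p0 s - g0) * (q1 0 - r1 0) - (p1 s - g1) * (q0 0 - r0 0)) ^ 2 := by
    rw [← hk]; ring
  have rhs : ((p0 0 - g0) * (k * (q1 0 - r1 0)) - (p1 0 - g1) * (k * (q0 0 - r0 0))) ^ 2 =
      1 / 3 * ((p0 0 - g0) * (q1 0 - r1 0) - (p1 0 - g1) * (q0 0 - r0 0)) ^ 2 := by
    rw [← hk]; ring
  rw [lhs, rhs, i0, i1]
  linear_combination (-2 / 3) * hFs + 4 / 3 * hs2 - 4 / 3 * h02

/-- If a positive periodic density gives every arc from `s` to `t s` a third of its total mass,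
then `t` has positive derivative and its third iterate is the translation by the period. -/
theorem third_iterate_of_integral_eq_third {f t t' : ℝ → ℝ} {L : ℝ} (hf : Continuous f)
    (hpos : ∀ s, 0 < f s) (hper : Function.Periodic f L) (ht : ∀ s, HasDerivAt t (t' s) s)
    (h : ∀ s, ∫ u in s..t s, f u = 1 / 3 * ∫ u in (0:ℝ)..L, f u) :
    (∀ s, 0 < t' s) ∧ ∀ s, t (t (t s)) = s + L := by
  let G : ℝ → ℝ := fun v => ∫ u in (0:ℝ)..v, f u
  have hi : ∀ a b, IntervalIntegrable f volume a b := fun a b => hf.intervalIntegrable a b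
  have hG : ∀ v, HasDerivAt G (f v) v := fun v =>
    integral_hasDerivAt_right (hi _ _) (hf.stronglyMeasurableAtFilter _ _) hf.continuousAt
  have hGt : ∀ s, G (t s) = G s + 1 / 3 * ∫ u in (0:ℝ)..L, f u := fun s => by
    rw [← h s]; exact (integral_add_adjacent_intervals (hi _ _) (hi _ _)).symm
  have hmono : StrictMono G := strictMono_of_hasDerivAt_pos hG hpos
  refine ⟨fun s => ?_, fun s => hmono.injective ?_⟩
  · have e : f (t s) * t' s = f s := ((hG (t s)).comp s (ht s)).unique
      (((hG s).add_const _).congr_of_eventuallyEq (.of_forall hGt))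
    exact pos_of_mul_pos_right (e ▸ hpos s) (hpos (t s)).le
  · have hL : G (s + L) = G s + ∫ u in (0:ℝ)..L, f u := by
      have := hper.intervalIntegral_add_eq s 0
      rw [zero_add] at this
      rw [← this]
      exact (integral_add_adjacent_intervals (hi _ _) (hi _ _)).symm
    rw [hGt, hGt, hGt, hL]; ring

/-- A continuous real function without zeros has constant sign, so positive combinations of its
values do not vanish. -/
theorem weighted_sum_ne_zero_of_continuous {h : ℝ → ℝ} (hc : Continuous h) (h0 : ∀ s, h s ≠ 0)
    {α β : ℝ} (hα : 0 < α) (hβ : 0 < β) (a b c : ℝ) : h a + α * h b + β * h c ≠ 0 := by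
  have hsame : ∀ a b, 0 < h a → 0 < h b := fun a b ha => by
    by_contra hb
    obtain ⟨v, hv⟩ := mem_range_of_exists_le_of_exists_ge hc ⟨b, not_lt.1 hb⟩ ⟨a, ha.le⟩
    exact h0 v hv
  rcases (h0 a).lt_or_gt with ha | ha
  · have hneg : ∀ v, h v < 0 := fun v =>
      (h0 v).lt_or_gt.resolve_right fun hv => (hsame v a hv).not_gt ha
    have := mul_neg_of_pos_of_neg hα (hneg b)
    have := mul_neg_of_pos_of_neg hβ (hneg c)
    linarith
  · have := mul_pos hα (hsame a b ha)
    have := mul_pos hβ (hsame a c ha)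
    linarith

/-- The homothety between buoyancy and flotation curves, differentiated: the sum of the endpoint
velocities is a multiple of the chord. -/
theorem flotation_velocity {γ : ℝ → R2} (hγ : ContDiff ℝ 2 γ) {t : ℝ → ℝ}
    (ht : ContDiff ℝ 1 t) {δ lam : ℝ} (hδ : δ ≠ 0) {z : R2}
    (hA : ∀ s, (1/2) * ∫ u in s..t s, det2 (γ u - γ s) (deriv γ u) = δ)
    (hhom : ∀ s, buoyCurve γ t δ s = z + lam • (flotCurve γ t s - z)) (s : ℝ) (i : Fin 2) :
    3 * δ * lam * (deriv γ s i + deriv t s * deriv γ (t s) i) =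
      det2 (deriv γ s) (γ (t s) - γ s) * (γ (t s) i - γ s i) := by
  have hd : ∀ s, HasDerivAt γ (deriv γ s) s := fun s =>
    (hγ.differentiable (by norm_num) s).hasDerivAt
  have hcoord : ∀ (i : Fin 2) s, HasDerivAt (fun u => γ u i) (deriv γ s i) s := fun i s =>
    (EuclideanSpace.proj (𝕜 := ℝ) i).hasFDerivAt.comp_hasDerivAt s (hd s)
  have hd' : Continuous (deriv γ) := hγ.continuous_deriv (by norm_num)
  have hc : Continuous γ := hγ.continuous
  have hcoord' : ∀ i : Fin 2, Continuous fun u => deriv γ u i := fun i => by fun_prop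
  have htd : ∀ s, HasDerivAt t (deriv t s) s := fun s =>
    (ht.differentiable (by norm_num) s).hasDerivAt
  have hA' : ∀ s, ∫ u in s..t s, ((γ u 0 - γ s 0) * deriv γ u 1 - (γ u 1 - γ s 1) * deriv γ u 0) =
      2 * δ := fun s => by
    have := hA s
    simp only [det2, PiLp.sub_apply] at this
    linarith
  have hB : ∀ (i : Fin 2) s, γ s i + 1 / (3 * δ) * (∫ u in s..t s,
      ((γ u 0 - γ s 0) * deriv γ u 1 - (γ u 1 - γ s 1) * deriv γ u 0) * (γ u i - γ s i)) =
      z i + lam * (1 / 2 * (γ s i + γ (t s) i) - z i) := fun i s => by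
    have h1 := congrArg (fun v : R2 => v i) (hhom s)
    have h2 := (EuclideanSpace.proj (𝕜 := ℝ) i).intervalIntegral_comp_comm (μ := volume)
      (a := s) (b := t s)
      (f := fun u => det2 (γ u - γ s) (deriv γ u) • (γ u - γ s))
      (Continuous.intervalIntegrable (by unfold det2; fun_prop) _ _)
    simp only [PiLp.proj_apply] at h2
    simp only [buoyCurve, flotCurve, PiLp.add_apply, PiLp.smul_apply, PiLp.sub_apply, smul_eq_mul,
      ← h2] at h1
    simpa only [det2, PiLp.sub_apply] using h1
  fin_cases i
  · exact flotation_velocity_coord hδ (hcoord 0) (hcoord 1) (hcoord' 0) (hcoord' 1) htd hA' (hB 0) s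
  · have := flotation_velocity_coord (neg_ne_zero.2 hδ) (hcoord 1) (hcoord 0) (hcoord' 1)
      (hcoord' 0) htd
      (fun s => by
        rw [mul_neg, ← hA' s, ← intervalIntegral.integral_neg]
        congr 1; ext u; ring)
      (z := z 1) (lam := lam)
      (fun s => by
        rw [← hB 1 s, mul_neg, div_neg, neg_mul, ← mul_neg, ← intervalIntegral.integral_neg]
        congr 3; ext u; ring) s
    simp only [det2, PiLp.sub_apply, Fin.mk_one] at this ⊢
    linear_combination -this

/-- if the flotation curve is homothetic to the buoyancy curve and every
chord of flotation cuts off one third of the total affine arc length, then `K` is an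
ellipse. -/
theorem stmt18
    (γ : ℝ → R2) (L : ℝ) (hL : 0 < L)
    (hγ : ContDiff ℝ 2 γ)
    (hper : ∀ s, γ (s + L) = γ s)
    (hreg : ∀ s, deriv γ s ≠ 0)
    (hinj : Set.InjOn γ (Set.Ico 0 L))
    (hor : 0 < ∫ s in (0:ℝ)..L, det2 (γ s) (deriv γ s))
    (K : Set R2) (hKconv : Convex ℝ K) (hKcomp : IsCompact K)
    (hKint : (interior K).Nonempty) (hKbd : frontier K = Set.range γ)
    (δ : ℝ) (hδ0 : 0 < δ) (hδK : δ < (volume K).toReal)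
    (t : ℝ → ℝ) (ht : ContDiff ℝ 1 t)
    (htrange : ∀ s, s < t s ∧ t s < s + L)
    (hA : ∀ s, (1/2) * ∫ u in s..t s, det2 (γ u - γ s) (deriv γ u) = δ)
    (hc1 : ∀ s, det2 (γ (t s) - γ s) (deriv γ s) ≠ 0)
    (hc2 : ∀ s, det2 (γ (t s) - γ s) (deriv γ (t s)) ≠ 0)
    (hcurv : ∀ s, 0 < det2 (deriv γ s) (deriv (deriv γ) s))
    (z : R2) (lam : ℝ) (hlam : 0 < lam)
    (hhom : ∀ s, buoyCurve γ t δ s = z + lam • (flotCurve γ t s - z))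
    (hthird : ∀ s, (∫ u in s..t s, det2 (deriv γ u) (deriv (deriv γ) u) ^ ((1:ℝ)/3)) =
      (1/3) * ∫ u in (0:ℝ)..L, det2 (deriv γ u) (deriv (deriv γ) u) ^ ((1:ℝ)/3)) :
    ∃ (T : R2 ≃ₗ[ℝ] R2) (b : R2),
      Set.range γ = (fun x => T x + b) '' Metric.sphere (0:R2) 1 := by
  have hd : ∀ s, HasDerivAt γ (deriv γ s) s := fun s =>
    (hγ.differentiable (by norm_num) s).hasDerivAt
  have hcoord : ∀ (i : Fin 2) s, HasDerivAt (fun u => γ u i) (deriv γ s i) s := fun i s =>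
    (EuclideanSpace.proj (𝕜 := ℝ) i).hasFDerivAt.comp_hasDerivAt s (hd s)
  have hd' : ContDiff ℝ 1 (deriv γ) := ContDiff.deriv' (n := 1) (by simpa [one_add_one_eq_two] using hγ)
  have hc' : Continuous (deriv γ) := hd'.continuous
  have hc'' : Continuous (deriv (deriv γ)) := hd'.continuous_deriv le_rfl
  have hc : Continuous γ := hγ.continuous
  have htc : Continuous t := ht.continuous
  have htd : ∀ s, HasDerivAt t (deriv t s) s := fun s =>
    (ht.differentiable (by norm_num) s).hasDerivAt
  have hper' : Function.Periodic (deriv γ) L := fun s => by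
    rw [← deriv_comp_add_const, funext hper]
  have hper'' : Function.Periodic (deriv (deriv γ)) L := fun s => by
    rw [← deriv_comp_add_const, funext hper']
  obtain ⟨htpos, ht3⟩ := third_iterate_of_integral_eq_third
    (f := fun u => det2 (deriv γ u) (deriv (deriv γ) u) ^ ((1:ℝ)/3))
    (Continuous.rpow_const (by unfold det2; fun_prop) fun _ => Or.inr (by norm_num))
    (fun s => Real.rpow_pos_of_pos (hcurv s) _)
    (fun s => by simp only [hper' s, hper'' s]) htd hthird
  have hm : 3 * δ * lam ≠ 0 := by positivity
  have hvel := flotation_velocity hγ ht hδ0.ne' hA hhom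
  have hsgn := fun s => weighted_sum_ne_zero_of_continuous
    (h := fun s => det2 (deriv γ s) (γ (t s) - γ s)) (by unfold det2; fun_prop)
    (fun s h => hc1 s (by unfold det2 at h ⊢; linear_combination -h))
    (htpos s) (mul_pos (htpos (t s)) (htpos s)) s (t s) (t (t s))
  have ht3' : ∀ s, deriv t (t (t s)) * (deriv t (t s) * deriv t s) = 1 := fun s =>
    ((htd (t (t s))).comp s ((htd (t s)).comp s (htd s))).unique
      (((hasDerivAt_id s).add_const L).congr_of_eventuallyEq (.of_forall ht3))
  have key : ∀ s, _ ∧ _ := fun s => by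
    have e1 := hvel s
    have e2 := hvel (t s)
    have e3 := hvel (t (t s))
    have hs := hsgn s
    have hT := ht3' s
    rw [ht3 s, hper, hper'] at e3
    simp only [ht3 s, hper] at hs
    simp only [det2, PiLp.sub_apply] at e1 e2 e3 hs
    exact triangle_velocity hm
      (u0 := deriv γ s 0) (u1 := deriv γ s 1)
      (v0 := deriv γ (t s) 0 * deriv t s) (v1 := deriv γ (t s) 1 * deriv t s)
      (w0 := deriv γ (t (t s)) 0 * (deriv t (t s) * deriv t s))
      (w1 := deriv γ (t (t s)) 1 * (deriv t (t s) * deriv t s))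
      (a0 := γ s 0) (a1 := γ s 1) (b0 := γ (t s) 0) (b1 := γ (t s) 1)
      (c0 := γ (t (t s)) 0) (c1 := γ (t (t s)) 1)
      (by linear_combination e1 0) (by linear_combination e1 1)
      (by linear_combination deriv t s * e2 0) (by linear_combination deriv t s * e2 1)
      (by linear_combination deriv t (t s) * deriv t s * e3 0 -
            3 * δ * lam * deriv γ s 0 * hT)
      (by linear_combination deriv t (t s) * deriv t s * e3 1 -
            3 * δ * lam * deriv γ s 1 * hT)
      (fun h => hs (by linear_combination h))
  choose hD φ hφ using key
  have hb : ∀ (i : Fin 2) s,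
      HasDerivAt (fun u => γ (t u) i) (deriv γ (t s) i * deriv t s) s := fun i s =>
    (hcoord i (t s)).comp s (htd s)
  have hcc : ∀ (i : Fin 2) s, HasDerivAt (fun u => γ (t (t u)) i)
      (deriv γ (t (t s)) i * (deriv t (t s) * deriv t s)) s := fun i s =>
    ((hb i (t s)).comp s (htd s)).congr_deriv (mul_assoc _ _ _)
  let g : R2 := (1 / 3 : ℝ) • (γ 0 + γ (t 0) + γ (t (t 0)))
  have hg : ∀ i : Fin 2, 3 * g i = γ 0 i + γ (t 0) i + γ (t (t 0)) i := fun i => by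
    simp only [g, PiLp.smul_apply, PiLp.add_apply, smul_eq_mul]; ring
  have hk : ((√3)⁻¹) ^ 2 = (1 / 3 : ℝ) := by
    rw [inv_pow, Real.sq_sqrt (by norm_num)]; norm_num
  have hk0 : (√3)⁻¹ ≠ 0 := by positivity
  have hinv := steiner_ellipse_invariant hk
    (fun s => (hcoord 0 s).congr_deriv (hφ s).1.1) (fun s => (hcoord 1 s).congr_deriv (hφ s).1.2)
    (fun s => (hb 0 s).congr_deriv (hφ s).2.1.1) (fun s => (hb 1 s).congr_deriv (hφ s).2.1.2)
    (fun s => (hcc 0 s).congr_deriv (hφ s).2.2.1) (fun s => (hcc 1 s).congr_deriv (hφ s).2.2.2)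
    hD (hg 0) (hg 1)
  rw [← hKbd]
  refine exists_frontier_eq_ellipse hKcomp hKint (γ 0 - g) ((√3)⁻¹ • (γ (t 0) - γ (t (t 0)))) g
    ?_ ?_
  · intro h
    simp only [det2, PiLp.sub_apply, PiLp.smul_apply, smul_eq_mul] at h
    apply mul_ne_zero hk0 hm
    linear_combination (√3)⁻¹ * (-hD 0) + 3 / 2 * h +
      (√3)⁻¹ / 2 * (γ (t 0) 1 - γ (t (t 0)) 1) * hg 0 -
      (√3)⁻¹ / 2 * (γ (t 0) 0 - γ (t (t 0)) 0) * hg 1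
  · rw [hKbd]
    rintro _ ⟨s, rfl⟩
    simp only [det2, PiLp.sub_apply, PiLp.smul_apply, smul_eq_mul]
    exact hinv s
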